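/- arXiv:math/0109202 — 2 statements merged into one kernel-verified Lean document; each statement's English description precedes it below -/
import Mathlib

section
/- The aligned double ring with two polar vortices D_{Nh}(2R,2p) is a relative equilibrium with explicit angular velocity (Theorem 3.7 and Proposition 3.8, case with poles): Let N ≥ 2, θ ∈ (0, π/2) and λ_n ∈ ℝ. Consider the configuration of n = 2N + 2 vortices with positions p j = (sin θ · cos (2πj/N), sin θ · sin (2πj/N), cos θ) of vorticity +1 and q j = (sin θ · cos (2πj/N), sin θ · sin (2πj/N), −cos θ) of vorticity −1 for j = 0, …, N−1, together with the North pole (0,0,1) of vorticity λ_n and the South pole (0,0,−1) of vorticity −λ_n. Set ξ = cos θ · [ (N−1)/sin²θ + Σ_{j=0}^{N−1} (1 + cos (2πj/N)) / (2 − sin²θ · (1 + cos (2πj/N))) ] + 2·λ_n/sin²θ. Then F(x) i = ξ • ((0,0,1) × x i) for every vortex x i of the configuration (in particular F vanishes at both poles), so the configuration is a relative equilibrium rotating about the z-axis with angular velocity ξ. -/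
open scoped RealInnerProductSpace BigOperators

noncomputable section

/-- Euclidean 3-space. -/
abbrev R3 : Type := EuclideanSpace ℝ (Fin 3)

/-- The vector of `R3` with the given coordinates. -/
def v3 (a b c : ℝ) : R3 := (WithLp.equiv 2 (Fin 3 → ℝ)).symm ![a, b, c]

/-- Cross product on `R3`. -/
def cross (u v : R3) : R3 :=
  v3 (u 1 * v 2 - u 2 * v 1) (u 2 * v 0 - u 0 * v 2) (u 0 * v 1 - u 1 * v 0)

/-- The point-vortex vector field on the sphere:
`F(x) i = Σ_{j ≠ i} (λ j / (1 − ⟪x i, x j⟫)) • (x j × x i)`. -/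
def vortexF {ι : Type} [Fintype ι] [DecidableEq ι] (lam : ι → ℝ) (x : ι → R3) (i : ι) : R3 :=
  ∑ j ∈ Finset.univ.filter (fun j => j ≠ i), (lam j / (1 - ⟪x i, x j⟫)) • cross (x j) (x i)

/-- The point-vortex Hamiltonian `H(y) = Σ_{i<j} λ i λ j log ‖y i − y j‖²`. -/
def vortexH (n : ℕ) (lam : Fin n → ℝ) (y : Fin n → R3) : ℝ :=
  ∑ p ∈ Finset.univ.filter (fun p : Fin n × Fin n => p.1 < p.2),
    lam p.1 * lam p.2 * Real.log (‖y p.1 - y p.2‖ ^ 2)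

/-- The centre of vorticity `Φ(y) = Σ_i λ i • y i`. -/
def vorticityCentre (n : ℕ) (lam : Fin n → ℝ) (y : Fin n → R3) : R3 := ∑ i, lam i • y i

theorem v3_inner (a b c d e f : ℝ) : ⟪v3 a b c, v3 d e f⟫ = a * d + b * e + c * f := by
  simp [v3, PiLp.inner_apply, Fin.sum_univ_three]
  ring

theorem cross_v3 (a b c d e f : ℝ) :
    cross (v3 a b c) (v3 d e f) = v3 (b * f - c * e) (c * d - a * f) (a * e - b * d) := by
  simp [cross, v3]

theorem cross_self_eq_zero (u : R3) : cross u u = 0 := by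
  ext k
  fin_cases k <;> simp [cross, v3] <;> ring

theorem smul_v3 (t a b c : ℝ) : t • v3 a b c = v3 (t * a) (t * b) (t * c) := by
  ext k
  fin_cases k <;> simp [v3]

theorem sum_v3 {ι : Type} [Fintype ι] (a b c : ι → ℝ) :
    ∑ j, v3 (a j) (b j) (c j) = v3 (∑ j, a j) (∑ j, b j) (∑ j, c j) := by
  ext k
  fin_cases k <;> simp [v3]

/-- The self-interaction term vanishes, so it may be included in the vortex field. -/
theorem vortexF_eq_sum {ι : Type} [Fintype ι] [DecidableEq ι] (lam : ι → ℝ) (x : ι → R3) (i : ι) :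
    vortexF lam x i = ∑ j, (lam j / (1 - ⟪x i, x j⟫)) • cross (x j) (x i) := by
  unfold vortexF
  refine Finset.sum_subset (Finset.filter_subset _ _) fun j _ hj => ?_
  obtain rfl : j = i := by simpa using hj
  rw [cross_self_eq_zero, smul_zero]

/-- The azimuth `2πj/N` of the `j`-th vertex of the regular `N`-gon. -/
def ringAngle (N : ℕ) (j : Fin N) : ℝ := 2 * Real.pi * ((j : ℕ) : ℝ) / (N : ℝ)

theorem sum_ringAngle_add {N : ℕ} (f : ℝ → ℝ) (hf : Function.Periodic f (2 * Real.pi))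
    (i : Fin N) : ∑ j, f (ringAngle N j + ringAngle N i) = ∑ j, f (ringAngle N j) := by
  have : NeZero N := ⟨(Fin.pos i).ne'⟩
  have hN : (N : ℝ) ≠ 0 := Nat.cast_ne_zero.mpr (NeZero.ne N)
  rw [← Equiv.sum_comp (Equiv.addRight i) fun j => f (ringAngle N j)]
  refine Finset.sum_congr rfl fun j _ => ?_
  have h : ((((j + i : Fin N) : ℕ) : ℝ)) + N * (((j : ℕ) + i) / N : ℕ) = (j : ℕ) + (i : ℕ) := by
    rw [Fin.val_add]
    exact_mod_cast Nat.mod_add_div ((j : ℕ) + i) N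
  have h2 : ringAngle N j + ringAngle N i
      = ringAngle N (j + i) + (((j : ℕ) + i) / N : ℕ) * (2 * Real.pi) := by
    unfold ringAngle
    field_simp
    linear_combination -h
  rw [h2, Equiv.coe_addRight]
  exact hf.nat_mul _ _

theorem sum_ringAngle_neg {N : ℕ} (f : ℝ → ℝ) (hf : Function.Periodic f (2 * Real.pi)) :
    ∑ j, f (-ringAngle N j) = ∑ j, f (ringAngle N j) := by
  rcases Nat.eq_zero_or_pos N with rfl | hpos
  · simp
  have : NeZero N := ⟨hpos.ne'⟩
  have hN : (N : ℝ) ≠ 0 := Nat.cast_ne_zero.mpr (NeZero.ne N)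
  rw [← Equiv.sum_comp (Equiv.neg (Fin N)) fun j => f (ringAngle N j)]
  refine Finset.sum_congr rfl fun j _ => ?_
  rw [Equiv.neg_apply]
  by_cases hj : j = 0
  · simp [hj, ringAngle]
  · have h : (((-j : Fin N) : ℕ) : ℝ) = N - (j : ℕ) := by
      rw [Fin.val_neg, if_neg hj, Nat.cast_sub j.2.le]
    have h2 : ringAngle N (-j) = -ringAngle N j + 2 * Real.pi := by
      unfold ringAngle
      rw [h]
      field_simp
      ring
    rw [h2, hf]

theorem sum_ringAngle_odd {N : ℕ} (f : ℝ → ℝ) (hf : Function.Periodic f (2 * Real.pi))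
    (hodd : ∀ t, f (-t) = -f t) : ∑ j, f (ringAngle N j) = 0 := by
  have h := sum_ringAngle_neg (N := N) f hf
  simp only [hodd, Finset.sum_neg_distrib] at h
  linarith

theorem cos_ringAngle_ne_one {N : ℕ} (j : Fin N) (hj : (j : ℕ) ≠ 0) :
    Real.cos (ringAngle N j) ≠ 1 := by
  have hN : (0 : ℝ) < N := Nat.cast_pos.mpr (Fin.pos j)
  have hj0 : (0 : ℝ) < (j : ℕ) := Nat.cast_pos.mpr (Nat.pos_of_ne_zero hj)
  have hjN : ((j : ℕ) : ℝ) < N := Nat.cast_lt.mpr j.2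
  have hpi := Real.pi_pos
  have h0 : 0 < ringAngle N j := by unfold ringAngle; positivity
  have h1 : ringAngle N j < 2 * Real.pi := by
    unfold ringAngle
    rw [div_lt_iff₀ hN]
    gcongr
  intro h
  exact h0.ne' ((Real.cos_eq_one_iff_of_lt_of_lt (by linarith) h1).mp h)

theorem sum_sin_ringAngle (N : ℕ) : ∑ j, Real.sin (ringAngle N j) = 0 :=
  sum_ringAngle_odd Real.sin Real.sin_periodic Real.sin_neg

theorem sum_cos_ringAngle {N : ℕ} (hN : 2 ≤ N) : ∑ j, Real.cos (ringAngle N j) = 0 := by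
  have h := sum_ringAngle_add Real.cos Real.cos_periodic (⟨1, hN⟩ : Fin N)
  simp only [Real.cos_add, Finset.sum_sub_distrib, ← Finset.sum_mul, sum_sin_ringAngle] at h
  have h1 := cos_ringAngle_ne_one (⟨1, hN⟩ : Fin N) one_ne_zero
  have h2 : (∑ j, Real.cos (ringAngle N j)) * (Real.cos (ringAngle N ⟨1, hN⟩) - 1) = 0 := by
    linear_combination h
  exact (mul_eq_zero.mp h2).resolve_right (sub_ne_zero.mpr h1)

/-- The point at height `h` and azimuth `t` on the cylinder of radius `s` about the `z`-axis. -/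
def cyl (s h t : ℝ) : R3 := v3 (s * Real.cos t) (s * Real.sin t) h

/-- The velocity that a ring of radius `s` and height `k` induces on a vertex of the aligned ring
at height `h` is azimuthal. -/
theorem sum_ring_on_ring {N : ℕ} (l s h k : ℝ) (i : Fin N) :
    ∑ j, (l / (1 - ⟪cyl s h (ringAngle N i), cyl s k (ringAngle N j)⟫)) •
        cross (cyl s k (ringAngle N j)) (cyl s h (ringAngle N i)) =
      (l * ∑ j, (k - h * Real.cos (ringAngle N j)) /
        (1 - h * k - s ^ 2 * Real.cos (ringAngle N j))) •
          cross (v3 0 0 1) (cyl s h (ringAngle N i)) := by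
  set a := ringAngle N i with ha
  set D : ℝ → ℝ := fun t => 1 - h * k - s ^ 2 * Real.cos t with hD
  have hin : ∀ b, 1 - ⟪cyl s h a, cyl s k b⟫ = D (b - a) := by
    intro b
    simp only [cyl, v3_inner, hD, Real.cos_sub]
    ring
  have hodd : ∑ j, Real.sin (ringAngle N j) / D (ringAngle N j) = 0 :=
    sum_ringAngle_odd (fun t => Real.sin t / D t) (fun t => by simp [hD])
      (fun t => by simp [hD, neg_div])
  have shift : ∀ f : ℝ → ℝ, Function.Periodic f (2 * Real.pi) →
      ∑ j, f (ringAngle N j - a) = ∑ j, f (ringAngle N j) := by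
    intro f hf
    rw [← sum_ringAngle_add (fun t => f (t - a)) (fun t => by
      simpa only [add_sub_right_comm] using hf (t - a)) i]
    simp [ha]
  have hodd' : ∑ j, Real.sin (ringAngle N j - a) / D (ringAngle N j - a) = 0 := by
    rw [shift (fun t => Real.sin t / D t) (fun t => by simp [hD]), hodd]
  have heven := shift (fun t => (k - h * Real.cos t) / D t) (fun t => by simp [hD])
  rw [← heven]
  have hsin : ∀ b, Real.sin b = Real.sin (b - a) * Real.cos a + Real.cos (b - a) * Real.sin a :=
    fun b => by rw [← Real.sin_add, sub_add_cancel]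
  have hcos : ∀ b, Real.cos b = Real.cos (b - a) * Real.cos a - Real.sin (b - a) * Real.sin a :=
    fun b => by rw [← Real.cos_add, sub_add_cancel]
  simp only [hin]
  simp only [cyl, cross_v3, smul_v3, sum_v3]
  congr 1
  · trans l * (∑ j, (k - h * Real.cos (ringAngle N j - a)) / D (ringAngle N j - a)) *
        (-(s * Real.sin a)) + l * s * h * Real.cos a *
        ∑ j, Real.sin (ringAngle N j - a) / D (ringAngle N j - a)
    · simp only [Finset.mul_sum, Finset.sum_mul, ← Finset.sum_add_distrib]
      refine Finset.sum_congr rfl fun j _ => ?_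
      rw [hsin (ringAngle N j)]
      ring
    · rw [hodd']; ring
  · trans l * (∑ j, (k - h * Real.cos (ringAngle N j - a)) / D (ringAngle N j - a)) *
        (s * Real.cos a) + l * s * h * Real.sin a *
        ∑ j, Real.sin (ringAngle N j - a) / D (ringAngle N j - a)
    · simp only [Finset.mul_sum, Finset.sum_mul, ← Finset.sum_add_distrib]
      refine Finset.sum_congr rfl fun j _ => ?_
      rw [hcos (ringAngle N j)]
      ring
    · rw [hodd']; ring
  · trans -(l * s ^ 2) * ∑ j, Real.sin (ringAngle N j - a) / D (ringAngle N j - a)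
    · simp only [Finset.mul_sum]
      refine Finset.sum_congr rfl fun j _ => ?_
      rw [Real.sin_sub]
      ring
    · rw [hodd']; ring

/-- A regular ring induces no velocity at a point of its axis. -/
theorem sum_ring_on_axis {N : ℕ} (hN : 2 ≤ N) (l s k t : ℝ) :
    ∑ j, (l / (1 - ⟪v3 0 0 t, cyl s k (ringAngle N j)⟫)) •
        cross (cyl s k (ringAngle N j)) (v3 0 0 t) = 0 := by
  simp only [cyl, v3_inner, zero_mul, zero_add, ← Finset.smul_sum, cross_v3, sum_v3]
  simp only [mul_zero, sub_zero, zero_sub, sub_self, Finset.sum_neg_distrib, ← Finset.sum_mul,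
    ← Finset.mul_sum, sum_sin_ringAngle, sum_cos_ringAngle hN, Finset.sum_const_zero]
  ext m
  fin_cases m <;> simp [v3]

theorem sum_same_ring {N : ℕ} (hN : 1 ≤ N) {s h : ℝ} (hs : s ≠ 0) (hsh : s ^ 2 + h ^ 2 = 1) :
    ∑ j : Fin N, (h - h * Real.cos (ringAngle N j)) /
        (1 - h * h - s ^ 2 * Real.cos (ringAngle N j)) = h * (((N : ℝ) - 1) / s ^ 2) := by
  obtain ⟨M, rfl⟩ : ∃ M, N = M + 1 := ⟨N - 1, by omega⟩
  rw [Fin.sum_univ_succ]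
  have h0 : ringAngle (M + 1) 0 = 0 := by simp [ringAngle]
  have hj : ∀ j : Fin M, (h - h * Real.cos (ringAngle (M + 1) j.succ)) /
      (1 - h * h - s ^ 2 * Real.cos (ringAngle (M + 1) j.succ)) = h / s ^ 2 := by
    intro j
    have hc := sub_ne_zero.mpr (cos_ringAngle_ne_one j.succ (by simp)).symm
    have hd : 1 - h * h - s ^ 2 * Real.cos (ringAngle (M + 1) j.succ)
        = s ^ 2 * (1 - Real.cos (ringAngle (M + 1) j.succ)) := by
      linear_combination -hsh
    rw [hd]
    field_simp
  simp only [hj, h0, Real.cos_zero, mul_one, sub_self, zero_div, zero_add, Finset.sum_const,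
    Finset.card_univ, Fintype.card_fin, nsmul_eq_mul]
  push_cast
  ring

theorem sum_opposite_ring {N : ℕ} {s h : ℝ} (hsh : s ^ 2 + h ^ 2 = 1) :
    ∑ j : Fin N, (-h - h * Real.cos (ringAngle N j)) /
        (1 - h * -h - s ^ 2 * Real.cos (ringAngle N j)) =
      -h * ∑ j : Fin N, (1 + Real.cos (ringAngle N j)) /
        (2 - s ^ 2 * (1 + Real.cos (ringAngle N j))) := by
  rw [Finset.mul_sum]
  refine Finset.sum_congr rfl fun j _ => ?_
  rw [← mul_div_assoc]
  congr 1
  · ring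
  · linear_combination hsh

/-- The pair of polar vortices of strengths `±l` rotates a point of height `h` and radius `s`. -/
theorem poles_on_ring (l : ℝ) {s h : ℝ} (hs : s ≠ 0) (hsh : s ^ 2 + h ^ 2 = 1) (a : ℝ) :
    (l / (1 - ⟪cyl s h a, v3 0 0 1⟫)) • cross (v3 0 0 1) (cyl s h a) +
      (-l / (1 - ⟪cyl s h a, v3 0 0 (-1)⟫)) • cross (v3 0 0 (-1)) (cyl s h a) =
      (2 * l / s ^ 2) • cross (v3 0 0 1) (cyl s h a) := by
  have hneg : cross (v3 0 0 (-1)) (cyl s h a) = (-1 : ℝ) • cross (v3 0 0 1) (cyl s h a) := by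
    simp only [cyl, cross_v3, smul_v3]
    congr 1 <;> ring
  have h2 : s ^ 2 = (1 - h) * (1 + h) := by linear_combination hsh
  have hprod : (1 - h) * (1 + h) ≠ 0 := h2 ▸ pow_ne_zero 2 hs
  have hm : 1 - h ≠ 0 := left_ne_zero_of_mul hprod
  have hp : 1 + h ≠ 0 := right_ne_zero_of_mul hprod
  rw [hneg, smul_smul, ← add_smul, h2]
  congr 1
  simp only [cyl, v3_inner, mul_zero, zero_add, mul_one, mul_neg, sub_neg_eq_add]
  field_simp
  ring

/-- the aligned double ring with two polar vortices `D_{Nh}(2R,2p)` is a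
relative equilibrium rotating about the `z`-axis with the explicit angular velocity of
Proposition 3.8 (`k_p = 2`); the pole indices are `Sum.inr true` (North, strength `λ_n`)
and `Sum.inr false` (South, strength `−λ_n`). -/
theorem DNh_double_ring_poles_relative_equilibrium (N : ℕ) (hN : 2 ≤ N)
    (θ : ℝ) (hθ : θ ∈ Set.Ioo 0 (Real.pi / 2)) (lamn : ℝ)
    (lam : (Fin N ⊕ Fin N) ⊕ Bool → ℝ) (x : (Fin N ⊕ Fin N) ⊕ Bool → R3) (ξ : ℝ)
    (hlamp : ∀ j : Fin N, lam (Sum.inl (Sum.inl j)) = 1)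
    (hlamm : ∀ j : Fin N, lam (Sum.inl (Sum.inr j)) = -1)
    (hlamn : lam (Sum.inr true) = lamn) (hlams : lam (Sum.inr false) = -lamn)
    (hxp : ∀ j : Fin N, x (Sum.inl (Sum.inl j)) =
      v3 (Real.sin θ * Real.cos (2 * Real.pi * ((j : ℕ) : ℝ) / (N : ℝ)))
         (Real.sin θ * Real.sin (2 * Real.pi * ((j : ℕ) : ℝ) / (N : ℝ)))
         (Real.cos θ))
    (hxm : ∀ j : Fin N, x (Sum.inl (Sum.inr j)) =
      v3 (Real.sin θ * Real.cos (2 * Real.pi * ((j : ℕ) : ℝ) / (N : ℝ)))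
         (Real.sin θ * Real.sin (2 * Real.pi * ((j : ℕ) : ℝ) / (N : ℝ)))
         (-Real.cos θ))
    (hxn : x (Sum.inr true) = v3 0 0 1) (hxs : x (Sum.inr false) = v3 0 0 (-1))
    (hξ : ξ = Real.cos θ * (((N : ℝ) - 1) / Real.sin θ ^ 2 +
      ∑ j : Fin N, (1 + Real.cos (2 * Real.pi * ((j : ℕ) : ℝ) / (N : ℝ))) /
        (2 - Real.sin θ ^ 2 * (1 + Real.cos (2 * Real.pi * ((j : ℕ) : ℝ) / (N : ℝ)))))
      + 2 * lamn / Real.sin θ ^ 2) :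
    ∀ i, vortexF lam x i = ξ • cross (v3 0 0 1) (x i) := by
  have hs : Real.sin θ ≠ 0 :=
    (Real.sin_pos_of_pos_of_lt_pi hθ.1 (by linarith [hθ.2, Real.pi_pos])).ne'
  have hsc : Real.sin θ ^ 2 + Real.cos θ ^ 2 = 1 := Real.sin_sq_add_cos_sq θ
  have hsc' : Real.sin θ ^ 2 + (-Real.cos θ) ^ 2 = 1 := by rw [neg_sq, hsc]
  have hp : ∀ j, x (Sum.inl (Sum.inl j)) = cyl (Real.sin θ) (Real.cos θ) (ringAngle N j) := hxp
  have hm : ∀ j, x (Sum.inl (Sum.inr j)) = cyl (Real.sin θ) (-Real.cos θ) (ringAngle N j) := hxm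
  change ξ = Real.cos θ * (((N : ℝ) - 1) / Real.sin θ ^ 2 +
      ∑ j : Fin N, (1 + Real.cos (ringAngle N j)) /
        (2 - Real.sin θ ^ 2 * (1 + Real.cos (ringAngle N j))))
      + 2 * lamn / Real.sin θ ^ 2 at hξ
  have hpole : ∀ t u : ℝ, cross (v3 0 0 t) (v3 0 0 u) = 0 := by
    intro t u
    rw [cross_v3]
    ext m
    fin_cases m <;> simp [v3]
  intro i
  rw [vortexF_eq_sum]
  simp only [Fintype.sum_sum_type, Fintype.sum_bool, hlamp, hlamm, hlamn, hlams, hp, hm, hxn, hxs]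
  rcases i with (i | i) | (_ | _)
  · rw [hp, sum_ring_on_ring, sum_ring_on_ring, poles_on_ring lamn hs hsc,
      sum_same_ring (by omega) hs hsc, sum_opposite_ring hsc, ← add_smul, ← add_smul, hξ]
    congr 1
    ring
  · have hopp := sum_opposite_ring (N := N) hsc'
    rw [neg_neg] at hopp
    rw [hm, sum_ring_on_ring, sum_ring_on_ring, poles_on_ring lamn hs hsc',
      sum_same_ring (by omega) hs hsc', hopp, ← add_smul, ← add_smul, hξ]
    congr 1
    ring
  · simp only [hxs, sum_ring_on_axis hN, hpole, smul_zero, add_zero]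
  · simp only [hxn, sum_ring_on_axis hN, hpole, smul_zero, add_zero]
end
end

section
/- The C_{2v}(R_m,R_m′) branch of four-vortex relative equilibria (Section 3.2.2, longitudinal rings with offset α = π): Let x, y ∈ (−1, 1) with x ≠ 0 and y ≠ 0. Consider the configuration of 4 vortices with positions P₁ = (√(1−x²), 0, x) and P₂ = (−√(1−y²), 0, −y) of vorticity +1, and P₃ = (−√(1−y²), 0, y) and P₄ = (√(1−x²), 0, −x) of vorticity −1. Then there exists ξ ∈ ℝ with F(p) i = ξ • ((0,0,1) × p i) for all four vortices p i (i.e. the configuration is a relative equilibrium rotating about the z-axis) if and only if (y + x) · ( 2·(y·x³ + x·y³ − x² − y² − x·y + 1) − (x² + y² + 2·x·y − 2)·√((1−x²)·(1−y²)) ) = 0. -/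
open scoped RealInnerProductSpace BigOperators

noncomputable section

lemma inner_v3 (a b c a' b' c' : ℝ) :
    ⟪v3 a b c, v3 a' b' c'⟫ = a * a' + b * b' + c * c' := by
  simp [v3, PiLp.inner_apply, Fin.sum_univ_three]
  ring

/-- The cross product of two vectors of the meridian plane `{y = 0}` points along the `y`-axis. -/
lemma cross_v3_meridian (r z r' z' : ℝ) :
    cross (v3 r 0 z) (v3 r' 0 z') = (z * r' - r * z') • v3 0 1 0 := by
  ext i
  fin_cases i <;> simp [cross, v3]

lemma v3_y_axis_ne_zero : v3 0 1 0 ≠ 0 := fun h => by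
  simpa [v3] using congrArg (fun v : R3 => v 1) h

/-- A configuration in the meridian plane rotates about the `z`-axis with angular velocity `ξ` iff
the `y`-components of the vortex velocities match. -/
lemma vortexF_meridian_eq_iff {ι : Type} [Fintype ι] [DecidableEq ι] (lam r z : ι → ℝ) (ξ : ℝ)
    (i : ι) :
    vortexF lam (fun j => v3 (r j) 0 (z j)) i = ξ • cross (v3 0 0 1) (v3 (r i) 0 (z i)) ↔
      ∑ j ∈ Finset.univ.filter (fun j => j ≠ i),
        lam j / (1 - (r i * r j + z i * z j)) * (z j * r i - r j * z i) = ξ * r i := by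
  simp only [vortexF, cross_v3_meridian, inner_v3, smul_smul, ← Finset.sum_smul]
  rw [(smul_left_injective ℝ v3_y_axis_ne_zero).eq_iff]
  simp

/-- the `C_{2v}(R_m,R_m′)` branch of four-vortex relative equilibria
(Section 3.2.2, longitudinal rings with offset `α = π`): the configuration is a relative
equilibrium about the `z`-axis iff
`(y + x)(2(yx³ + xy³ − x² − y² − xy + 1) − (x² + y² + 2xy − 2)√((1−x²)(1−y²))) = 0`. -/
theorem C2v_RmRmp_relative_equilibrium_iff (x y : ℝ)
    (hx : x ∈ Set.Ioo (-1 : ℝ) 1) (hy : y ∈ Set.Ioo (-1 : ℝ) 1)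
    (hx0 : x ≠ 0) (hy0 : y ≠ 0)
    (p : Fin 4 → R3) (lam : Fin 4 → ℝ)
    (hp : p = ![v3 (Real.sqrt (1 - x ^ 2)) 0 x, v3 (-Real.sqrt (1 - y ^ 2)) 0 (-y),
                v3 (-Real.sqrt (1 - y ^ 2)) 0 y, v3 (Real.sqrt (1 - x ^ 2)) 0 (-x)])
    (hlam : lam = ![1, 1, -1, -1]) :
    (∃ ξ : ℝ, ∀ i, vortexF lam p i = ξ • cross (v3 0 0 1) (p i)) ↔
      (y + x) * (2 * (y * x ^ 3 + x * y ^ 3 - x ^ 2 - y ^ 2 - x * y + 1)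
        - (x ^ 2 + y ^ 2 + 2 * x * y - 2) * Real.sqrt ((1 - x ^ 2) * (1 - y ^ 2))) = 0 := by
  obtain ⟨hx1, hx2⟩ := hx
  obtain ⟨hy1, hy2⟩ := hy
  have hxx : 0 < 1 - x ^ 2 := by nlinarith
  have hyy : 0 < 1 - y ^ 2 := by nlinarith
  rw [Real.sqrt_mul hxx.le]
  have ha2 := Real.sq_sqrt hxx.le
  have hb2 := Real.sq_sqrt hyy.le
  have ha := Real.sqrt_pos.2 hxx
  have hb := Real.sqrt_pos.2 hyy
  set a := √(1 - x ^ 2)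
  set b := √(1 - y ^ 2)
  have hab := mul_pos ha hb
  have hS : 0 < 1 + a * b + x * y := by nlinarith [sq_nonneg (x + y)]
  have hD : 0 < 1 + a * b - x * y := by nlinarith [sq_nonneg (x - y)]
  have hp' : p = fun j => v3 (![a, -b, -b, a] j) 0 (![x, -y, y, -x] j) := by
    rw [hp]
    funext j
    fin_cases j <;> rfl
  have key : ∀ ξ : ℝ, (∀ i, vortexF lam p i = ξ • cross (v3 0 0 1) (p i)) ↔
      ((b * x - a * y) / (1 + a * b + x * y) - (b * x + a * y) / (1 + a * b - x * y) + a / x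
          = ξ * a ∧
        -(b * x - a * y) / (1 + a * b + x * y) - (b * x + a * y) / (1 + a * b - x * y) + b / y
          = -(ξ * b)) := by
    intro ξ
    have h14 : 1 - (a * a + x * -x) = 2 * x ^ 2 := by linear_combination -ha2
    have h41 : 1 - (a * a + -x * x) = 2 * x ^ 2 := by linear_combination -ha2
    have h23 : 1 - (-b * -b + -y * y) = 2 * y ^ 2 := by linear_combination -hb2
    have h32 : 1 - (-b * -b + y * -y) = 2 * y ^ 2 := by linear_combination -hb2
    have h12 : 1 - (a * -b + x * -y) = 1 + a * b + x * y := by ring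
    have h21 : 1 - (-b * a + -y * x) = 1 + a * b + x * y := by ring
    have h34 : 1 - (-b * a + y * -x) = 1 + a * b + x * y := by ring
    have h43 : 1 - (a * -b + -x * y) = 1 + a * b + x * y := by ring
    have h13 : 1 - (a * -b + x * y) = 1 + a * b - x * y := by ring
    have h31 : 1 - (-b * a + y * x) = 1 + a * b - x * y := by ring
    have h24 : 1 - (-b * a + -y * -x) = 1 + a * b - x * y := by ring
    have h42 : 1 - (a * -b + -x * -y) = 1 + a * b - x * y := by ring
    have hxa : a / x = 1 / (2 * x ^ 2) * (2 * a * x) := by field_simp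
    have hyb : b / y = 1 / (2 * y ^ 2) * (2 * b * y) := by field_simp
    rw [hp']
    simp only [vortexF_meridian_eq_iff, Finset.sum_filter, Fin.sum_univ_four, Fin.forall_fin_succ,
      hlam]
    simp [-neg_mul, -mul_neg, h12, h13, h14, h21, h23, h24, h31, h32, h34,
      h41, h42, h43, hxa, hyb]
    constructor
    · rintro ⟨h1, h2, -, -⟩
      exact ⟨by linear_combination h1, by linear_combination h2⟩
    · rintro ⟨h1, h2⟩
      exact ⟨by linear_combination h1, by linear_combination h2, by linear_combination h2,
        by linear_combination h1⟩
  simp only [key]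
  trans b * ((b * x - a * y) / (1 + a * b + x * y) - (b * x + a * y) / (1 + a * b - x * y) + a / x)
      + a * (-(b * x - a * y) / (1 + a * b + x * y) - (b * x + a * y) / (1 + a * b - x * y) + b / y)
      = 0
  · constructor
    · rintro ⟨ξ, h1, h2⟩
      rw [h1, h2]
      ring
    · intro h
      refine ⟨((b * x - a * y) / (1 + a * b + x * y) - (b * x + a * y) / (1 + a * b - x * y)
        + a / x) / a, ?_, ?_⟩
      · field_simp
      · rw [← mul_right_inj' ha.ne', eq_neg_of_add_eq_zero_right h]
        field_simp
  · have hne : (1 + a * b + x * y) * (1 + a * b - x * y) * (x * y) ≠ 0 := by positivity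
    rw [← mul_right_inj' hne, mul_zero]
    suffices h : (1 + a * b + x * y) * (1 + a * b - x * y) * (x * y) *
        (b * ((b * x - a * y) / (1 + a * b + x * y) - (b * x + a * y) / (1 + a * b - x * y) + a / x)
        + a * (-(b * x - a * y) / (1 + a * b + x * y) - (b * x + a * y) / (1 + a * b - x * y)
          + b / y)) = (y + x) * (2 * (y * x ^ 3 + x * y ^ 3 - x ^ 2 - y ^ 2 - x * y + 1)
        - (x ^ 2 + y ^ 2 + 2 * x * y - 2) * (a * b)) by rw [h]
    have hS' := hS.ne'
    have hD' := hD.ne'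
    field_simp
    linear_combination ((x + y) * (2 - 2 * x * y + a * b) * b ^ 2 - 2 * (x * y) ^ 2 * y) * ha2 +
      ((x + y) * (2 - 2 * x * y + a * b) * (1 - x ^ 2) - 2 * (x * y) ^ 2 * x) * hb2
end
end
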